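/- arXiv:1511.05767 — 2 statements merged into one kernel-verified Lean document; each statement's English description precedes it below -/
import Mathlib

section
/- Let n ≥ 3, let g ∈ SL(n,ℤ), and let u₁, u₂ ∈ SL(n,ℤ) be rank-1 unipotent elements such that p_{u₂} = g • p_{u₁} and L_{u₂} ≠ g • L_{u₁}. Then u₁ and g⁻¹u₂g commute and ⟨u₁, g⁻¹u₂g⟩ ≅ ℤ². -/
/- Common setup: `SL(n,ℤ)`, `SL(n,ℝ)`, the real projective space `ℙ^{n-1}(ℝ)`
with its quotient topology and the projective action, rank-1 unipotent elements
and their attracting points / fixed hyperplanes, metrics compatible with the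
topology of `ℙ`, `ε`-neighbourhoods, Schottky systems, profinite density,
maximal subgroups, and lattices in `SL(n,ℝ)`. -/

open Matrix LinearAlgebra.Projectivization

abbrev SLZ (n : ℕ) := Matrix.SpecialLinearGroup (Fin n) ℤ

abbrev SLR (n : ℕ) := Matrix.SpecialLinearGroup (Fin n) ℝ

/-- The real projective space `ℙ^{n-1}(ℝ)`: the projectivization of `ℝⁿ`. -/
abbrev Proj (n : ℕ) := Projectivization ℝ (Fin n → ℝ)

/-- The quotient topology on `ℙ^{n-1}(ℝ)`. -/
noncomputable instance (n : ℕ) : TopologicalSpace (Proj n) :=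
  inferInstanceAs (TopologicalSpace (Quotient _))

/-- The action of `SL(n,ℝ)` on `ℙ^{n-1}(ℝ)` induced by the linear action on `ℝⁿ`. -/
noncomputable def actR {n : ℕ} (g : SLR n) (x : Proj n) : Proj n :=
  Projectivization.map (Matrix.SpecialLinearGroup.toLin' g).toLinearMap
    (Matrix.SpecialLinearGroup.toLin' g).injective x

/-- The action of `SL(n,ℤ)` on `ℙ^{n-1}(ℝ)` induced by the linear action on `ℝⁿ`. -/
noncomputable def act {n : ℕ} (g : SLZ n) (x : Proj n) : Proj n :=
  actR (Matrix.SpecialLinearGroup.map (Int.castRingHom ℝ) g) x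

/-- The real matrix attached to `g ∈ SL(n,ℤ)`. -/
noncomputable def matR {n : ℕ} (g : SLZ n) : Matrix (Fin n) (Fin n) ℝ :=
  ((Matrix.SpecialLinearGroup.map (Int.castRingHom ℝ)) g : Matrix (Fin n) (Fin n) ℝ)

/-- The subspace `Im(u - I) ⊆ ℝⁿ` (a line when `u` is rank-1 unipotent). -/
noncomputable def lineOf {n : ℕ} (u : SLZ n) : Submodule ℝ (Fin n → ℝ) :=
  LinearMap.range (Matrix.mulVecLin (matR u - 1))

/-- The subspace `ker(u - I) ⊆ ℝⁿ` (a hyperplane when `u` is rank-1 unipotent). -/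
noncomputable def hypOf {n : ℕ} (u : SLZ n) : Submodule ℝ (Fin n → ℝ) :=
  LinearMap.ker (Matrix.mulVecLin (matR u - 1))

/-- The rational matrix attached to `g ∈ SL(n,ℤ)`. -/
noncomputable def matQ {n : ℕ} (g : SLZ n) : Matrix (Fin n) (Fin n) ℚ :=
  ((Matrix.SpecialLinearGroup.map (Int.castRingHom ℚ)) g : Matrix (Fin n) (Fin n) ℚ)

/-- `g - I`, as a `ℚ`-linear endomorphism of `ℚⁿ`. -/
noncomputable def linQ {n : ℕ} (g : SLZ n) : (Fin n → ℚ) →ₗ[ℚ] (Fin n → ℚ) :=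
  Matrix.mulVecLin (matQ g - 1)

/-- `u` is a rank-1 unipotent element of `SL(n,ℤ)`: `u - I` is nilpotent of rank one. -/
def IsR1U {n : ℕ} (u : SLZ n) : Prop :=
  IsNilpotent (linQ u) ∧ Module.finrank ℚ (LinearMap.range (linQ u)) = 1

/-- The point of attraction `p_u` of `u`, as a subset of `ℙ` (a singleton when `u` is a
rank-1 unipotent): the projective points whose representative spans `Im(u - I)`. -/
def attSet {n : ℕ} (u : SLZ n) : Set (Proj n) :=
  {x | x.submodule = lineOf u}

/-- The fixed hyperplane `L_u` of `u`, as a subset of `ℙ`. -/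
def fixSet {n : ℕ} (u : SLZ n) : Set (Proj n) :=
  {x | x.submodule ≤ hypOf u}

/-- The subset of `ℙ` corresponding to a linear subspace `W ⊆ ℝⁿ`. -/
def projSet {n : ℕ} (W : Submodule ℝ (Fin n → ℝ)) : Set (Proj n) :=
  {x | x.submodule ≤ W}

/-- The image `g • W` of a subspace of `ℝⁿ` under `g ∈ SL(n,ℤ)`. -/
noncomputable def actSub {n : ℕ} (g : SLZ n) (W : Submodule ℝ (Fin n → ℝ)) :
    Submodule ℝ (Fin n → ℝ) :=
  Submodule.map (Matrix.mulVecLin (matR g)) W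

/-- The image `g • W` of a subspace of `ℝⁿ` under `g ∈ SL(n,ℝ)`. -/
noncomputable def actSubR {n : ℕ} (g : SLR n) (W : Submodule ℝ (Fin n → ℝ)) :
    Submodule ℝ (Fin n → ℝ) :=
  Submodule.map (Matrix.mulVecLin (g : Matrix (Fin n) (Fin n) ℝ)) W

/-- `d` is a metric on `ℙ^{n-1}(ℝ)` inducing the quotient topology. -/
structure IsCompatMetric {n : ℕ} (d : Proj n → Proj n → ℝ) : Prop where
  self : ∀ x, d x x = 0
  eq_of : ∀ x y, d x y = 0 → x = y
  symm : ∀ x y, d x y = d y x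
  triangle : ∀ x y z, d x z ≤ d x y + d y z
  inducing : ∀ s : Set (Proj n), IsOpen s ↔ ∀ x ∈ s, ∃ ε > 0, ∀ y, d x y < ε → y ∈ s

/-- The distance from a point to a set. -/
noncomputable def setDist {n : ℕ} (d : Proj n → Proj n → ℝ) (x : Proj n)
    (A : Set (Proj n)) : ℝ :=
  sInf (d x '' A)

/-- The open `ε`-neighbourhood `(A)_ε = {x | dist(x, A) < ε}`. -/
def oThick {n : ℕ} (d : Proj n → Proj n → ℝ) (A : Set (Proj n)) (ε : ℝ) : Set (Proj n) :=
  {x | setDist d x A < ε}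

/-- The closed `ε`-neighbourhood `[A]_ε = {x | dist(x, A) ≤ ε}`. -/
def cThick {n : ℕ} (d : Proj n → Proj n → ℝ) (A : Set (Proj n)) (ε : ℝ) : Set (Proj n) :=
  {x | setDist d x A ≤ ε}

/-- The Hausdorff distance between two subsets of `ℙ`. -/
noncomputable def hDist {n : ℕ} (d : Proj n → Proj n → ℝ) (A B : Set (Proj n)) : ℝ :=
  max (sSup ((fun a => setDist d a B) '' A)) (sSup ((fun b => setDist d b A) '' B))

/-- A rational point of `ℙ`: one spanned by a vector of `ℚⁿ`. -/
def RatPoint {n : ℕ} (p : Proj n) : Prop :=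
  ∃ v : Fin n → ℚ, p.submodule = Submodule.span ℝ {fun i => ((v i : ℝ))}

/-- A subspace of `ℝⁿ` spanned by vectors of `ℚⁿ`. -/
def IsRatSubmodule {n : ℕ} (W : Submodule ℝ (Fin n → ℝ)) : Prop :=
  ∃ T : Set (Fin n → ℚ),
    W = Submodule.span ℝ ((fun (v : Fin n → ℚ) (i : Fin n) => ((v i : ℝ))) '' T)

/-- A Schottky system `(S, 𝒜, ℛ)` with respect to the metric `d`: `S` is a nonempty
set of rank-1 unipotents, `𝒜 ⊆ ℛ` are closed, and for each `u ∈ S` there are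
`δ_u ≥ ε_u > 0` satisfying the ping-pong conditions. -/
structure IsSchottky {n : ℕ} (d : Proj n → Proj n → ℝ) (S : Set (SLZ n))
    (A R : Set (Proj n)) : Prop where
  nonempty : S.Nonempty
  unip : ∀ u ∈ S, IsR1U u
  AsubR : A ⊆ R
  closedA : IsClosed A
  closedR : IsClosed R
  cond : ∃ ε δ : SLZ n → ℝ, (∀ u ∈ S, 0 < ε u ∧ ε u ≤ δ u) ∧
    (∀ u ∈ S, ∀ k : ℤ, k ≠ 0 → ∀ x, x ∉ oThick d (fixSet u) (δ u) →
      act (u ^ k) x ∈ oThick d (attSet u) (ε u)) ∧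
    (∀ u ∈ S, ∀ v ∈ S, u ≠ v → oThick d (attSet u) (ε u) ∩ oThick d (fixSet v) (δ v) = ∅) ∧
    (∀ u ∈ S, oThick d (attSet u) (ε u) ⊆ A) ∧
    (∀ u ∈ S, oThick d (fixSet u) (δ u) ⊆ R)

/-- `H` is profinitely dense in `G`: `HN = G` for every finite-index normal `N ⊴ G`. -/
def ProfinitelyDense {G : Type*} [Group G] (H : Subgroup G) : Prop :=
  ∀ N : Subgroup G, N.Normal → N.FiniteIndex → H ⊔ N = ⊤

/-- `M` is a maximal (proper) subgroup of `G`. -/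
def IsMaxSubgroup {G : Type*} [Group G] (M : Subgroup G) : Prop :=
  M ≠ ⊤ ∧ ∀ K : Subgroup G, M < K → K = ⊤

noncomputable instance (n : ℕ) : TopologicalSpace (SLR n) :=
  inferInstanceAs (TopologicalSpace {A : Matrix (Fin n) (Fin n) ℝ // A.det = 1})

noncomputable instance (n : ℕ) : MeasurableSpace (SLR n) := borel _

/-- `Γ ≤ SL(n,ℝ)` is a lattice: a discrete subgroup admitting a Borel fundamental
domain of finite Haar measure. -/
def IsLatticeIn {n : ℕ} (Γ : Subgroup (SLR n)) : Prop :=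
  DiscreteTopology Γ ∧
  ∃ μ : MeasureTheory.Measure (SLR n), μ.IsHaarMeasure ∧
    ∃ D : Set (SLR n), MeasurableSet D ∧ μ D < ⊤ ∧
      ∀ g : SLR n, ∃! γ : Γ, (γ : SLR n)⁻¹ * g ∈ D

theorem LinearMap.mul_self_eq_zero_of_isNilpotent_of_finrank_range_eq_one
    {K V : Type*} [Field K] [AddCommGroup V] [Module K V]
    {f : Module.End K V} (hf : IsNilpotent f)
    (h : Module.finrank K (LinearMap.range f) = 1) : f * f = 0 := by
  obtain ⟨⟨x, y, hy⟩, hx0, hx⟩ := finrank_eq_one_iff'.mp h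
  have hrange : ∀ z, ∃ c : K, f z = c • x := fun z => by
    obtain ⟨c, hc⟩ := hx ⟨f z, z, rfl⟩
    exact ⟨c, (congrArg Subtype.val hc).symm⟩
  have hx0' : x ≠ 0 := fun h0 => hx0 (Subtype.ext h0)
  obtain ⟨c, hc⟩ := hrange x
  have hpow : ∀ k : ℕ, (f ^ k) x = c ^ k • x := fun k => by
    induction k with
    | zero => simp
    | succ k ih => rw [pow_succ, Module.End.mul_apply, hc, map_smul, ih, smul_smul, pow_succ']
  obtain ⟨k, hk⟩ := hf
  have hck : c ^ k • x = 0 := by rw [← hpow, hk, LinearMap.zero_apply]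
  have hc0 : c = 0 := eq_zero_of_pow_eq_zero ((smul_eq_zero.mp hck).resolve_right hx0')
  ext z
  obtain ⟨d, hd⟩ := hrange z
  simp [Module.End.mul_apply, hd, hc, hc0]

/-- The integer matrix underlying `g ∈ SL(n,ℤ)`. -/
def matZ {n : ℕ} (g : SLZ n) : Matrix (Fin n) (Fin n) ℤ := g

theorem matZ_one {n : ℕ} : matZ (1 : SLZ n) = 1 := rfl

theorem matZ_mul {n : ℕ} (g h : SLZ n) : matZ (g * h) = matZ g * matZ h := rfl

theorem matZ_injective {n : ℕ} : Function.Injective (matZ (n := n)) := Subtype.val_injective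

theorem matQ_sub_one {n : ℕ} (u : SLZ n) :
    matQ u - 1 = (matZ u - 1).map (Int.castRingHom ℚ) := by
  rw [Matrix.map_sub _ (map_sub _), Matrix.map_one _ (map_zero _) (map_one _)]
  rfl

theorem matR_sub_one {n : ℕ} (u : SLZ n) :
    matR u - 1 = (matZ u - 1).map (Int.castRingHom ℝ) := by
  rw [Matrix.map_sub _ (map_sub _), Matrix.map_one _ (map_zero _) (map_one _)]
  rfl

theorem IsR1U.sub_one_mul_self {n : ℕ} {u : SLZ n} (h : IsR1U u) :
    (matZ u - 1) * (matZ u - 1) = 0 := by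
  have hq := LinearMap.mul_self_eq_zero_of_isNilpotent_of_finrank_range_eq_one h.1 h.2
  rw [linQ, Module.End.mul_eq_comp, ← Matrix.mulVecLin_mul, matQ_sub_one,
    ← Matrix.map_mul] at hq
  refine Matrix.map_injective (Int.castRingHom ℚ).injective_int ?_
  beta_reduce
  rw [Matrix.map_zero _ (map_zero _)]
  exact Matrix.toLin'.injective (by simpa [Matrix.toLin'_apply'] using hq)

theorem IsR1U.sub_one_ne_zero {n : ℕ} {u : SLZ n} (h : IsR1U u) : matZ u - 1 ≠ 0 := fun h0 => by
  have h1 := h.2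
  rw [linQ, matQ_sub_one, h0, Matrix.map_zero _ (map_zero _), Matrix.mulVecLin_zero,
    LinearMap.range_zero, finrank_bot] at h1
  exact zero_ne_one h1

theorem matZ_zpow_of_sub_one_mul_self {n : ℕ} {u : SLZ n}
    (h : (matZ u - 1) * (matZ u - 1) = 0) (r : ℤ) : matZ (u ^ r) = 1 + r • (matZ u - 1) := by
  obtain ⟨a, ha⟩ : ∃ a, a = matZ u - 1 := ⟨_, rfl⟩
  have hu : matZ u = 1 + a := by rw [ha, add_sub_cancel]
  rw [← ha] at h ⊢
  have key : ∀ c d : ℤ, (1 + c • a) * (1 + d • a) = 1 + (c + d) • a := fun c d => by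
    simp only [add_mul, mul_add, smul_mul_assoc, mul_smul_comm, h, smul_zero, one_mul, mul_one,
      add_smul]
    abel_nf
  have hu' : matZ u = 1 + (1 : ℤ) • a := by rw [hu, one_smul]
  induction r using Int.induction_on with
  | zero => simp [matZ_one]
  | succ i ih =>
    rw [_root_.zpow_add_one, matZ_mul, ih, hu', key]
  | pred i ih =>
    have hm : matZ (u ^ (-(i : ℤ) - 1)) * matZ u = matZ (u ^ (-(i : ℤ))) := by
      rw [← matZ_mul, ← _root_.zpow_add_one, sub_add_cancel]
    calc matZ (u ^ (-(i : ℤ) - 1))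
        = matZ (u ^ (-(i : ℤ) - 1)) * (matZ u * (1 + (-1 : ℤ) • a)) := by rw [hu', key]; simp
      _ = _ := by rw [← mul_assoc, hm, ih, key]; rfl

theorem Matrix.mul_eq_zero_of_range_mulVecLin_eq_map {n : ℕ} {K : Type*} [Field K]
    {A B G H : Matrix (Fin n) (Fin n) K} (hHG : H * G = 1) (hA : A * A = 0) (hB : B * B = 0)
    (h : LinearMap.range B.mulVecLin = (LinearMap.range A.mulVecLin).map G.mulVecLin) :
    A * H * B = 0 ∧ B * G * A = 0 := by
  constructor <;> refine Matrix.mulVec_injective (funext fun x => ?_)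
  · obtain ⟨_, ⟨y, rfl⟩, hy⟩ : B *ᵥ x ∈ (LinearMap.range A.mulVecLin).map G.mulVecLin :=
      h ▸ ⟨x, rfl⟩
    rw [← Matrix.mulVec_mulVec, ← hy]
    simp only [Matrix.mulVecLin_apply, Matrix.mulVec_mulVec]
    rw [mul_assoc A, ← mul_assoc H, hHG, one_mul, hA, Matrix.zero_mulVec, Matrix.zero_mulVec]
  · obtain ⟨y, hy⟩ : G *ᵥ (A *ᵥ x) ∈ LinearMap.range B.mulVecLin :=
      h.symm ▸ ⟨A *ᵥ x, ⟨x, rfl⟩, rfl⟩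
    rw [← Matrix.mulVec_mulVec, ← Matrix.mulVec_mulVec, ← hy]
    simp [Matrix.mulVec_mulVec, hB]

theorem Matrix.ker_mulVecLin_eq_map_of_smul_add_smul_eq_zero {n : ℕ} {K : Type*} [Field K]
    {A B G H : Matrix (Fin n) (Fin n) K} (hHG : H * G = 1) {r s : K} (hr : r ≠ 0) (hs : s ≠ 0)
    (h : r • A + s • (H * B * G) = 0) :
    LinearMap.ker B.mulVecLin = (LinearMap.ker A.mulVecLin).map G.mulVecLin := by
  have hGH : G * H = 1 := mul_eq_one_comm.mp hHG
  have hv : ∀ x, r • (A *ᵥ x) + s • (H *ᵥ (B *ᵥ (G *ᵥ x))) = 0 := fun x => by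
    have := congrArg (· *ᵥ x) h
    simpa [Matrix.add_mulVec, Matrix.smul_mulVec, ← Matrix.mulVec_mulVec] using this
  ext x
  simp only [Submodule.mem_map, LinearMap.mem_ker, Matrix.mulVecLin_apply]
  constructor
  · intro hx
    have hGHx : G *ᵥ (H *ᵥ x) = x := by rw [Matrix.mulVec_mulVec, hGH, Matrix.one_mulVec]
    refine ⟨H *ᵥ x, ?_, hGHx⟩
    simpa [hGHx, hx, hr] using hv (H *ᵥ x)
  · rintro ⟨y, hy, rfl⟩
    have hH : H *ᵥ (B *ᵥ (G *ᵥ y)) = 0 := by simpa [hy, hs] using hv y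
    simpa [Matrix.mulVec_mulVec, ← mul_assoc, hGH] using congrArg (G *ᵥ ·) hH

/-- Lemma 2.8: if `u₁, u₂` are rank-1 unipotents with `p_{u₂} = g • p_{u₁}` and
`L_{u₂} ≠ g • L_{u₁}`, then `u₁` and `g⁻¹u₂g` commute and generate `ℤ²`. -/
theorem commuting_unipotent_pair (n : ℕ) (hn : 3 ≤ n) (g u₁ u₂ : SLZ n)
    (h₁ : IsR1U u₁) (h₂ : IsR1U u₂)
    (hp : lineOf u₂ = actSub g (lineOf u₁))
    (hL : hypOf u₂ ≠ actSub g (hypOf u₁)) :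
    u₁ * (g⁻¹ * u₂ * g) = (g⁻¹ * u₂ * g) * u₁ ∧
      ∀ r s : ℤ, u₁ ^ r * (g⁻¹ * u₂ * g) ^ s = 1 → r = 0 ∧ s = 0 := by
  let ρ : Matrix (Fin n) (Fin n) ℤ →+* Matrix (Fin n) (Fin n) ℝ :=
    (Int.castRingHom ℝ).mapMatrix
  have hρ : Function.Injective ρ := Matrix.map_injective (Int.castRingHom ℝ).injective_int
  have hHG : matZ g⁻¹ * matZ g = 1 := by rw [← matZ_mul, inv_mul_cancel, matZ_one]
  have hGH : matZ g * matZ g⁻¹ = 1 := by rw [← matZ_mul, mul_inv_cancel, matZ_one]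
  have hv : matZ (g⁻¹ * u₂ * g) - 1 = matZ g⁻¹ * (matZ u₂ - 1) * matZ g := by
    rw [mul_sub, sub_mul, mul_one, hHG, matZ_mul, matZ_mul]
  have haa := h₁.sub_one_mul_self
  have hbb := h₂.sub_one_mul_self
  have ha0 := h₁.sub_one_ne_zero
  have hb0 := h₂.sub_one_ne_zero
  obtain ⟨v, hvdef⟩ : ∃ v, v = g⁻¹ * u₂ * g := ⟨_, rfl⟩
  rw [← hvdef] at hv ⊢
  rw [lineOf, lineOf, actSub, matR_sub_one, matR_sub_one] at hp
  rw [hypOf, hypOf, actSub, matR_sub_one, matR_sub_one] at hL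
  have hρHG : ρ (matZ g⁻¹) * ρ (matZ g) = 1 := by rw [← map_mul, hHG, map_one]
  obtain ⟨hab, hba⟩ := Matrix.mul_eq_zero_of_range_mulVecLin_eq_map
    (A := ρ (matZ u₁ - 1)) (B := ρ (matZ u₂ - 1)) hρHG
    (by rw [← map_mul, haa, map_zero]) (by rw [← map_mul, hbb, map_zero]) hp
  rw [← map_mul, ← map_mul, map_eq_zero_iff ρ hρ] at hab hba
  have huv : (matZ u₁ - 1) * (matZ v - 1) = 0 := by
    rw [hv, ← mul_assoc, ← mul_assoc, hab, zero_mul]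
  have hvu : (matZ v - 1) * (matZ u₁ - 1) = 0 := by
    rw [hv, mul_assoc, mul_assoc, ← mul_assoc (matZ u₂ - 1), hba, mul_zero]
  have hvv : (matZ v - 1) * (matZ v - 1) = 0 := by
    calc (matZ v - 1) * (matZ v - 1)
        = matZ g⁻¹ * ((matZ u₂ - 1) * (matZ g * matZ g⁻¹) * (matZ u₂ - 1)) * matZ g := by
          rw [hv]; simp only [mul_assoc]
      _ = 0 := by rw [hGH, mul_one, hbb, mul_zero, zero_mul]
  have hv0 : matZ v - 1 ≠ 0 := fun h0 => hb0 <| by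
    calc matZ u₂ - 1 = matZ g * matZ g⁻¹ * (matZ u₂ - 1) * (matZ g * matZ g⁻¹) := by
          rw [hGH, one_mul, mul_one]
      _ = matZ g * (matZ g⁻¹ * (matZ u₂ - 1) * matZ g) * matZ g⁻¹ := by simp only [mul_assoc]
      _ = 0 := by rw [← hv, h0, mul_zero, zero_mul]
  refine ⟨matZ_injective ?_, fun r s hrs => ?_⟩
  · have h := huv.trans hvu.symm
    rw [matZ_mul, matZ_mul]
    simp only [mul_sub, sub_mul, mul_one, one_mul] at h
    rw [← sub_eq_zero] at h ⊢
    rw [← h]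
    abel
  · have h : r • (matZ u₁ - 1) + s • (matZ v - 1) = 0 := by
      have h := congrArg matZ hrs
      rw [matZ_mul, matZ_zpow_of_sub_one_mul_self haa,
        matZ_zpow_of_sub_one_mul_self hvv, mul_add, mul_one,
        add_mul, smul_mul_smul_comm, huv, smul_zero, add_zero, one_mul,
        matZ_one, add_assoc, add_eq_left] at h
      exact h
    by_cases hr : r = 0
    · exact ⟨hr, by
        rw [hr, zero_smul, zero_add] at h
        exact (smul_eq_zero.mp h).resolve_right hv0⟩
    by_cases hs : s = 0
    · exact ⟨by
        rw [hs, zero_smul, add_zero] at h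
        exact (smul_eq_zero.mp h).resolve_right ha0, hs⟩
    refine absurd (Matrix.ker_mulVecLin_eq_map_of_smul_add_smul_eq_zero hρHG
      (Int.cast_ne_zero.mpr hr) (Int.cast_ne_zero.mpr hs) ?_) hL
    have h' := congrArg ρ h
    rw [hv, map_add, map_zsmul, map_zsmul, map_mul, map_mul, map_zero] at h'
    rw [Int.cast_smul_eq_zsmul, Int.cast_smul_eq_zsmul]
    exact h'
end

section
/- Let n ≥ 3 and let Γ ≤ SL(n,ℝ) be a lattice, i.e. a discrete subgroup admitting a Borel fundamental domain of finite Haar measure in SL(n,ℝ). Let X be the set of generic (n−1)-tuples of ℙ, i.e. tuples (p₁,…,p_{n−1}) ∈ ℙ^{n−1} whose representative vectors in ℝⁿ are linearly independent, with the subspace topology from the product ℙ^{n−1}. Then the diagonal action of Γ on X is minimal: every Γ-orbit in X is dense in X. -/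
/- Common setup: `SL(n,ℤ)`, `SL(n,ℝ)`, the real projective space `ℙ^{n-1}(ℝ)`
with its quotient topology and the projective action, rank-1 unipotent elements
and their attracting points / fixed hyperplanes, metrics compatible with the
topology of `ℙ`, `ε`-neighbourhoods, Schottky systems, profinite density,
maximal subgroups, and lattices in `SL(n,ℝ)`. -/

open Matrix LinearAlgebra.Projectivization

section FiniteCovolume

open MeasureTheory Set Filter Topology Pointwise

/-- The elements of `G` contracted to `1` by conjugation by the powers of `a`. -/
def contractedSet {G : Type*} [Group G] [TopologicalSpace G] (a : G) : Set G :=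
  {u | Tendsto (fun k : ℕ ↦ a ^ k * u * (a ^ k)⁻¹) atTop (𝓝 1)}

/-- Right translates of a fundamental domain for a left action are fundamental domains. -/
theorem isFundamentalDomain_preimage_mul_right {G : Type*} [Group G]
    [TopologicalSpace G] [IsTopologicalGroup G] [MeasurableSpace G] [BorelSpace G]
    {Γ : Subgroup G} {μ : Measure G} {D : Set G} (hDm : MeasurableSet D)
    (hD : ∀ g : G, ∃! γ : Γ, γ • g ∈ D) (g : G) :
    IsFundamentalDomain Γ ((· * g) ⁻¹' D) μ :=
  .mk' (measurable_mul_const g hDm).nullMeasurableSet fun x ↦ by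
    simpa [smul_mul_assoc] using hD (x * g)

variable {G : Type*} [Group G] [TopologicalSpace G] [IsTopologicalGroup G]
  [LocallyCompactSpace G] [SecondCountableTopology G] [MeasurableSpace G] [BorelSpace G]
  {Γ : Subgroup G} [Countable Γ] {μ : Measure G} [μ.IsHaarMeasure] {D : Set G}

/-- A locally compact group with a discrete subgroup of finite covolume is unimodular. -/
theorem isMulRightInvariant_of_fundamentalDomain (hDm : MeasurableSet D)
    (hD : ∀ g : G, ∃! γ : Γ, γ • g ∈ D) (hfin : μ D ≠ ⊤) : μ.IsMulRightInvariant := by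
  have hfd : IsFundamentalDomain Γ D μ := .mk' hDm.nullMeasurableSet hD
  have h0 : μ D ≠ 0 := hfd.measure_ne_zero (NeZero.ne μ)
  refine ⟨fun g ↦ ?_⟩
  have hmap := Measure.isMulLeftInvariant_eq_smul (μ.map (· * g)) μ
  have hval : μ.map (· * g) D = μ D := by
    rw [Measure.map_apply (measurable_mul_const g) hDm]
    exact (isFundamentalDomain_preimage_mul_right hDm hD g).measure_eq hfd
  rw [hmap] at hval ⊢
  have hc : ((Measure.haarScalarFactor (μ.map (· * g)) μ : NNReal) : ENNReal) = 1 := by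
    have h : ((Measure.haarScalarFactor (μ.map (· * g)) μ : NNReal) : ENNReal) * μ D = 1 * μ D := by
      rwa [one_mul]
    exact (ENNReal.mul_left_inj h0 hfin).1 h
  rw [ENNReal.coe_eq_one.1 hc, one_smul]

theorem measure_preimage_mul_right_inter (hDm : MeasurableSet D)
    (hD : ∀ g : G, ∃! γ : Γ, γ • g ∈ D) [μ.IsMulRightInvariant] {S : Set G}
    (hS : MeasurableSet S) (hΓ : ∀ γ : Γ, (γ • ·) ⁻¹' S = S) (g : G) :
    μ ((· * g) ⁻¹' S ∩ D) = μ (S ∩ D) := by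
  have hfd : IsFundamentalDomain Γ D μ := .mk' hDm.nullMeasurableSet hD
  have h1 := hfd.measure_set_eq (isFundamentalDomain_preimage_mul_right hDm hD g⁻¹) hS hΓ
  rw [h1, ← measure_preimage_mul_right μ g (S ∩ _)]
  congr 1
  ext x
  simp

theorem measure_eq_zero_of_inter_fundamentalDomain (hDm : MeasurableSet D)
    (hD : ∀ g : G, ∃! γ : Γ, γ • g ∈ D) {S : Set G}
    (hΓ : ∀ γ : Γ, (γ • ·) ⁻¹' S = S) (h : μ (S ∩ D) = 0) : μ S = 0 := by
  have hfd : IsFundamentalDomain Γ D μ := .mk' hDm.nullMeasurableSet hD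
  refine hfd.measure_zero_of_invariant S (fun γ ↦ ?_) h
  rw [← preimage_smul_inv]
  exact hΓ γ⁻¹

/-- The Mautner phenomenon for open sets: an open set which is `Γ`-invariant on the left and
`a`-invariant on the right is almost invariant under every element contracted by
conjugation by powers of `a`. -/
theorem ae_eq_preimage_of_contracted (hDm : MeasurableSet D)
    (hD : ∀ g : G, ∃! γ : Γ, γ • g ∈ D) (hfin : μ D ≠ ⊤) [μ.IsMulRightInvariant]
    {E : Set G} (hE : IsOpen E) (hΓ : ∀ γ : Γ, (γ • ·) ⁻¹' E = E)
    {a u : G} (ha : (· * a) ⁻¹' E = E)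
    (hu : u ∈ contractedSet a) :
    (· * u) ⁻¹' E =ᵐ[μ] E := by
  have hapow (k : ℕ) : ∀ x, x * a ^ k ∈ E ↔ x ∈ E := by
    induction k with
    | zero => simp
    | succ k ih =>
      intro x
      rw [pow_succ, ← mul_assoc, ← ih x]
      exact Set.ext_iff.1 ha _
  have hEu (g : G) : IsOpen ((· * g) ⁻¹' E) := hE.preimage (continuous_mul_const g)
  have hΓu (g : G) (γ : Γ) : (γ • ·) ⁻¹' ((· * g) ⁻¹' E) = (· * g) ⁻¹' E := by
    ext x
    simpa [smul_mul_assoc] using Set.ext_iff.1 (hΓ γ) (x * g)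
  have hdiff (k : ℕ) : μ ((E \ (· * (a ^ k * u * (a ^ k)⁻¹)) ⁻¹' E) ∩ D) =
      μ ((E \ (· * u) ⁻¹' E) ∩ D) := by
    rw [← measure_preimage_mul_right_inter (μ := μ) hDm hD
      (hE.measurableSet.diff (hEu u).measurableSet) (fun γ ↦ by rw [preimage_sdiff, hΓ, hΓu])
      (a ^ k)]
    congr 2
    ext x
    have := hapow k (x * (a ^ k * u * (a ^ k)⁻¹))
    simp only [mul_assoc, inv_mul_cancel, mul_one] at this
    simp [hapow k x, mul_assoc, this]
  have : IsFiniteMeasure (μ.restrict D) := ⟨by simpa using hfin.lt_top⟩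
  have hlim : Tendsto (fun k : ℕ ↦ μ.restrict D (E \ (· * (a ^ k * u * (a ^ k)⁻¹)) ⁻¹' E)) atTop
      (𝓝 (μ.restrict D ∅)) := by
    refine tendsto_measure_of_tendsto_indicator_of_isFiniteMeasure _ _
      (fun k ↦ hE.measurableSet.diff (hEu _).measurableSet) fun x ↦ ?_
    by_cases hx : x ∈ E
    · have h1 : Tendsto (fun k : ℕ ↦ x * (a ^ k * u * (a ^ k)⁻¹)) atTop (𝓝 x) := by
        simpa using Tendsto.const_mul x hu
      filter_upwards [h1.eventually_mem (hE.mem_nhds hx)] with k hk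
      simp [hk]
    · simp [hx]
  simp_rw [Measure.restrict_apply (hE.measurableSet.diff (hEu _).measurableSet), hdiff] at hlim
  have hsub : E ≤ᵐ[μ.restrict D] (· * u) ⁻¹' E := by
    rw [ae_le_set, Measure.restrict_apply (hE.measurableSet.diff (hEu _).measurableSet)]
    simpa using tendsto_nhds_unique tendsto_const_nhds hlim
  have heq : E =ᵐ[μ.restrict D] (· * u) ⁻¹' E := by
    refine ae_eq_of_ae_subset_of_measure_ge hsub ?_ hE.measurableSet.nullMeasurableSet
      (measure_ne_top _ _)
    rw [Measure.restrict_apply (hEu u).measurableSet, Measure.restrict_apply hE.measurableSet,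
      measure_preimage_mul_right_inter hDm hD hE.measurableSet hΓ]
  rw [← measure_symmDiff_eq_zero_iff] at heq ⊢
  rw [Measure.restrict_apply (hE.measurableSet.symmDiff (hEu _).measurableSet)] at heq
  rw [symmDiff_comm]
  refine measure_eq_zero_of_inter_fundamentalDomain hDm hD (fun γ ↦ ?_) heq
  simp only [symmDiff_def, sup_eq_union, preimage_union, preimage_sdiff, hΓ, hΓu]

/-- If `G` is generated by the elements contracted by conjugation by positive or negative powers
of `a`, then every nonempty open set which is `Γ`-invariant on the left and `a`-invariant on the
right is dense. -/
theorem dense_of_isOpen_of_invariant (hDm : MeasurableSet D)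
    (hD : ∀ g : G, ∃! γ : Γ, γ • g ∈ D) (hfin : μ D ≠ ⊤) [μ.IsMulRightInvariant]
    {E : Set G} (hE : IsOpen E) (hne : E.Nonempty) (hΓ : ∀ γ : Γ, (γ • ·) ⁻¹' E = E)
    {a : G} (ha : (· * a) ⁻¹' E = E)
    (hgen : Subgroup.closure (contractedSet a ∪ contractedSet a⁻¹) = ⊤) :
    Dense E := by
  have ha' : (· * a⁻¹) ⁻¹' E = E := by
    nth_rw 1 [← ha]
    ext x
    simp
  have key (g : G) : (· * g) ⁻¹' E =ᵐ[μ] E := by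
    have hcomp (g h : G) (hh : (· * h) ⁻¹' E =ᵐ[μ] E) :
        (· * (g * h)) ⁻¹' E =ᵐ[μ] (· * g) ⁻¹' E := by
      simpa [preimage_preimage, mul_assoc] using
        (measurePreserving_mul_right μ g).quasiMeasurePreserving.preimage_ae_eq hh
    have hg : g ∈ Subgroup.closure (contractedSet a ∪ contractedSet a⁻¹) :=
      hgen ▸ Subgroup.mem_top g
    induction hg using Subgroup.closure_induction with
    | mem u hu =>
      rcases hu with hu | hu
      · exact ae_eq_preimage_of_contracted hDm hD hfin hE hΓ ha hu
      · exact ae_eq_preimage_of_contracted hDm hD hfin hE hΓ ha' hu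
    | one => simp only [mul_one]; rfl
    | mul g h _ _ ihg ihh => exact (hcomp g h ihh).trans ihg
    | inv g _ ih => simpa using (hcomp g⁻¹ g ih).symm
  obtain ⟨x, hx⟩ := hne
  rw [dense_iff_inter_open]
  rintro V hV ⟨v, hv⟩
  by_contra hVE
  rw [not_nonempty_iff_eq_empty] at hVE
  have hg := key (v⁻¹ * x)
  have hopen : IsOpen (V ∩ (· * (v⁻¹ * x)) ⁻¹' E) :=
    hV.inter (hE.preimage (continuous_mul_const _))
  refine (hopen.measure_pos μ ⟨v, hv, by simpa using hx⟩).ne' ?_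
  refine measure_mono_null ?_ (ae_le_set.1 hg.le)
  exact fun y hy ↦ ⟨hy.2, fun hyE ↦ (Set.ext_iff.1 hVE y).1 ⟨hy.1, hyE⟩⟩

/-- Topological transitivity in forward time: under the hypotheses of
`dense_of_isOpen_of_invariant`, forward invariance of the open set suffices. -/
theorem dense_of_isOpen_of_forward_invariant (hDm : MeasurableSet D)
    (hD : ∀ g : G, ∃! γ : Γ, γ • g ∈ D) (hfin : μ D ≠ ⊤) [μ.IsMulRightInvariant]
    {E : Set G} (hE : IsOpen E) (hne : E.Nonempty) (hΓ : ∀ γ : Γ, (γ • ·) ⁻¹' E = E)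
    {a : G} (ha : ∀ x ∈ E, x * a ∈ E)
    (hgen : Subgroup.closure (contractedSet a ∪ contractedSet a⁻¹) = ⊤) :
    Dense E := by
  have hEu (g : G) : IsOpen ((· * g) ⁻¹' E) := hE.preimage (continuous_mul_const g)
  have hΓu (g : G) (γ : Γ) : (γ • ·) ⁻¹' ((· * g) ⁻¹' E) = (· * g) ⁻¹' E := by
    ext x
    simpa [smul_mul_assoc] using Set.ext_iff.1 (hΓ γ) (x * g)
  have hpow (k : ℕ) : ∀ x ∈ E, x * a ^ k ∈ E := by
    induction k with
    | zero => simp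
    | succ k ih =>
      intro x hx
      rw [pow_succ, ← mul_assoc]
      exact ha _ (ih x hx)
  have hdense : Dense (⋃ k : ℕ, (· * a ^ k) ⁻¹' E) := by
    refine dense_of_isOpen_of_invariant hDm hD hfin (isOpen_iUnion fun k ↦ hEu _)
      (hne.mono fun x hx ↦ mem_iUnion.2 ⟨0, by simpa using hx⟩) (fun γ ↦ ?_) ?_ hgen
    · simp only [preimage_iUnion, hΓu]
    · ext x
      simp only [preimage_iUnion, mem_iUnion, mem_preimage]
      constructor
      · rintro ⟨k, hk⟩
        exact ⟨k + 1, by rwa [pow_succ', ← mul_assoc]⟩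
      · rintro ⟨k, hk⟩
        refine ⟨k, ?_⟩
        rw [mul_assoc, ← pow_succ', pow_succ, ← mul_assoc]
        exact ha _ hk
  by_contra hnd
  obtain ⟨x, hx⟩ : (closure E)ᶜ.Nonempty := by
    rwa [nonempty_compl, Ne, ← dense_iff_closure_eq]
  obtain ⟨y, hyE, hy⟩ := hdense.inter_open_nonempty _ isClosed_closure.isOpen_compl ⟨x, hx⟩
  obtain ⟨k, hk⟩ := mem_iUnion.1 hy
  have hmeas : μ (((· * a ^ k) ⁻¹' E \ E) ∩ D) = 0 := by
    have : IsFiniteMeasure (μ.restrict D) := ⟨by simpa using hfin.lt_top⟩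
    rw [← Measure.restrict_apply ((hEu _).measurableSet.diff hE.measurableSet),
      measure_sdiff (show E ⊆ (· * a ^ k) ⁻¹' E from hpow k) hE.measurableSet.nullMeasurableSet
        (measure_ne_top _ _),
      Measure.restrict_apply (hEu _).measurableSet, Measure.restrict_apply hE.measurableSet,
      measure_preimage_mul_right_inter hDm hD hE.measurableSet hΓ, tsub_self]
  have hnull := measure_eq_zero_of_inter_fundamentalDomain hDm hD
    (fun γ ↦ by rw [preimage_sdiff, hΓ, hΓu]) hmeas
  refine (((hEu (a ^ k)).inter isClosed_closure.isOpen_compl).measure_pos μ ⟨y, hk, hyE⟩).ne'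
    (measure_mono_null ?_ hnull)
  exact fun z hz ↦ ⟨hz.1, fun h ↦ hz.2 (subset_closure h)⟩

/-- If a neighbourhood of `1` is covered by `H`-cosets of elements on which conjugation by
negative powers of `a ∈ H` is uniformly small, then every double coset `Γ g H` is dense. -/
theorem dense_doubleCoset (hDm : MeasurableSet D)
    (hD : ∀ g : G, ∃! γ : Γ, γ • g ∈ D) (hfin : μ D ≠ ⊤) [μ.IsMulRightInvariant]
    {a : G} {H : Subgroup G} (haH : a ∈ H)
    (hgen : Subgroup.closure (contractedSet a ∪ contractedSet a⁻¹) = ⊤)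
    (hH : ∀ N ∈ 𝓝 (1 : G), ∀ᶠ x in 𝓝 (1 : G), ∃ h ∈ H,
      ∀ k : ℕ, (a ^ k)⁻¹ * (h⁻¹ * x) * a ^ k ∈ N) (g : G) :
    Dense {x : G | ∃ γ : Γ, ∃ h ∈ H, x = γ * g * h} := by
  rw [dense_iff_inter_open]
  rintro V hV ⟨v, hv⟩
  have hdiv : Tendsto (fun p : G × G ↦ p.1 * p.2⁻¹) (𝓝 v ×ˢ 𝓝 1) (𝓝 v) := by
    have : Continuous fun p : G × G ↦ p.1 * p.2⁻¹ := by fun_prop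
    simpa [nhds_prod_eq] using this.tendsto (v, 1)
  obtain ⟨V₁, hV₁, N, hN, hVN⟩ := mem_prod_iff.1 (hdiv (hV.mem_nhds hv))
  obtain ⟨O, hO, hOo, h1O⟩ := eventually_nhds_iff.1 (hH N hN)
  set E : Set G := {x | ∃ γ : Γ, ∃ k : ℕ, g⁻¹ * (γ * x) * (a ^ k)⁻¹ ∈ O} with hEdef
  have hE : IsOpen E := by
    simp only [hEdef, ofPred_exists]
    exact isOpen_iUnion fun γ ↦ isOpen_iUnion fun k ↦ hOo.preimage (by fun_prop)
  have hdense : Dense E := by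
    refine dense_of_isOpen_of_forward_invariant hDm hD hfin hE ⟨g, 1, 0, by simpa using h1O⟩
      (fun γ ↦ ?_) ?_ hgen
    · ext x
      constructor
      · rintro ⟨γ', k, h⟩
        exact ⟨γ' * γ, k, by simpa [mul_assoc, Subgroup.smul_def] using h⟩
      · rintro ⟨γ', k, h⟩
        exact ⟨γ' * γ⁻¹, k, by simpa [mul_assoc, Subgroup.smul_def] using h⟩
    · rintro x ⟨γ, k, h⟩
      refine ⟨γ, k + 1, ?_⟩
      have : g⁻¹ * (γ * (x * a)) * (a ^ (k + 1))⁻¹ = g⁻¹ * (γ * x) * (a ^ k)⁻¹ := by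
        rw [pow_succ']
        group
      rwa [this]
  obtain ⟨x, hxV, γ, k, hx⟩ := mem_closure_iff_nhds.1 (hdense v) V₁ hV₁
  obtain ⟨h, hh, hN'⟩ := hO _ hx
  refine ⟨x * ((a ^ k)⁻¹ * (h⁻¹ * (g⁻¹ * (γ * x) * (a ^ k)⁻¹)) * a ^ k)⁻¹,
    hVN (mk_mem_prod hxV (hN' k)), γ⁻¹, h * a ^ k, H.mul_mem hh (H.pow_mem haH k), ?_⟩
  push_cast
  group

end FiniteCovolume

namespace Matrix.SpecialLinearGroup

variable {ι F : Type*} [Fintype ι] [DecidableEq ι] [Field F]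

/-- The product homomorphism on the diagonal torus. -/
def torusDet (ι F : Type*) [Fintype ι] [Field F] : (ι → Fˣ) →* Fˣ where
  toFun D := ∏ i, D i
  map_one' := by simp
  map_mul' D D' := Finset.prod_mul_distrib

/-- The diagonal torus of the special linear group. -/
def diagonalHom : (torusDet ι F).ker →* SpecialLinearGroup ι F where
  toFun D := ⟨diagonal fun i ↦ (D.1 i : F), by
    have h : ∏ i, D.1 i = 1 := D.2
    rw [det_diagonal, ← Units.coe_prod, h, Units.val_one]⟩
  map_one' := by ext; simp [Matrix.one_apply, Matrix.diagonal_apply]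
  map_mul' D D' := Subtype.ext (diagonal_mul_diagonal _ _).symm

theorem coe_diagonalHom (D : (torusDet ι F).ker) :
    (diagonalHom D : Matrix ι ι F) = diagonal fun i ↦ (D.1 i : F) := rfl

theorem diagonalHom_conj_apply (D : (torusDet ι F).ker) (x : SpecialLinearGroup ι F) (i j : ι) :
    (diagonalHom D * x * (diagonalHom D)⁻¹) i j = (D.1 i : F) * (D.1 j : F)⁻¹ * x i j := by
  rw [← map_inv, coe_mul, coe_mul, coe_diagonalHom, coe_diagonalHom, Matrix.mul_diagonal,
    Matrix.diagonal_mul]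
  simp only [InvMemClass.coe_inv, Pi.inv_apply, Units.val_inv_eq_inv_val]
  ring

/-- The coroot `x ↦ diag(x, x⁻¹)` in the coordinates `i`, `l`. -/
def coroot (i l : ι) (x : Fˣ) : (torusDet ι F).ker :=
  ⟨Pi.mulSingle i x * Pi.mulSingle l x⁻¹, by
    simp [MonoidHom.mem_ker, torusDet, Finset.prod_mul_distrib]⟩

theorem prod_coroot (l : ι) (D : (torusDet ι F).ker) : ∏ i, coroot i l (D.1 i) = D := by
  have h : ∏ i, D.1 i = 1 := D.2
  have h' : ∏ i, Pi.mulSingle (M := fun _ ↦ Fˣ) l (D.1 i)⁻¹ = 1 := by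
    refine (map_prod (MonoidHom.mulSingle (fun _ : ι ↦ Fˣ) l) _ _).symm.trans ?_
    simp [Finset.prod_inv_distrib, h]
  ext1
  rw [Subgroup.val_finsetProd]
  simp only [coroot, Finset.prod_mul_distrib, Finset.univ_prod_mulSingle, h', mul_one]

theorem diagonalHom_coroot {i l : ι} (h : i ≠ l) (x : Fˣ) :
    diagonalHom (coroot i l x) = transvection h (x : F) * transvection h.symm (-(x : F)⁻¹) *
      transvection h ((x : F) - 1) * transvection h.symm 1 * transvection h (-1) := by
  have hx : (x : F) ≠ 0 := x.ne_zero
  have hdiag : (diagonalHom (coroot i l x) : Matrix ι ι F) =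
      1 + ((x : F) - 1) • single i i 1 + ((x : F)⁻¹ - 1) • single l l 1 := by
    ext p q
    rcases eq_or_ne p q with rfl | hpq
    · by_cases hp : p = i <;> by_cases hl : p = l <;>
        simp_all [coe_diagonalHom, coroot, Pi.mulSingle_apply, Matrix.single_apply, eq_comm]
    · have (r : ι) : ¬(r = p ∧ r = q) := fun ⟨h₁, h₂⟩ ↦ hpq (h₁.symm.trans h₂)
      simp [coe_diagonalHom, hpq, this]
  have hsingle (p q : ι) (c : F) : single p q c = c • single p q (1 : F) := by simp
  refine Subtype.ext ?_
  simp only [coe_mul, hdiag, transvection_coe]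
  rw [hsingle i l, hsingle l i, hsingle i l (_ - 1), hsingle i l (-1)]
  simp only [mul_add, add_mul, single_mul_single_same, mul_one, one_mul,
    mul_smul_comm, smul_mul_assoc, single_mul_single_of_ne _ _ _ _ h,
    single_mul_single_of_ne _ _ _ _ h.symm, smul_zero, add_zero]
  match_scalars <;> field_simp <;> ring

theorem transvection_eq_commutator {i j l : ι} (hij : i ≠ j) (hil : i ≠ l) (hlj : l ≠ j) (b : F) :
    transvection hij b =
      transvection hil b * transvection hlj 1 * transvection hil (-b) * transvection hlj (-1) := by
  refine Subtype.ext ?_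
  simp only [coe_mul, transvection_coe, mul_add, add_mul, single_mul_single_same,
    single_mul_single_of_ne _ _ _ _ hij.symm,
    single_mul_single_of_ne _ _ _ _ hil.symm, single_mul_single_of_ne _ _ _ _ hlj.symm, mul_one,
    one_mul]
  simp only [mul_neg, mul_one, ← single_neg, add_zero, zero_mul]
  abel

/-- The special linear group is generated by the transvections in the row and the column of a
fixed index. -/
theorem closure_transvection_eq_top (l : ι) :
    Subgroup.closure {g : SpecialLinearGroup ι F | ∃ (i : ι) (h : i ≠ l) (b : F),
      g = transvection h b ∨ g = transvection h.symm b} = ⊤ := by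
  set K := Subgroup.closure {g : SpecialLinearGroup ι F | ∃ (i : ι) (h : i ≠ l) (b : F),
      g = transvection h b ∨ g = transvection h.symm b}
  have hcol {i : ι} (h : i ≠ l) (b : F) : transvection h b ∈ K :=
    Subgroup.subset_closure ⟨i, h, b, .inl rfl⟩
  have hrow {i : ι} (h : l ≠ i) (b : F) : transvection h b ∈ K :=
    Subgroup.subset_closure ⟨i, h.symm, b, .inr rfl⟩
  have hall {i j : ι} (h : i ≠ j) (b : F) : transvection h b ∈ K := by
    by_cases hi : i = l
    · subst hi; exact hrow h b
    by_cases hj : j = l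
    · subst hj; exact hcol h b
    rw [transvection_eq_commutator h hi (Ne.symm hj)]
    exact K.mul_mem (K.mul_mem (K.mul_mem (hcol _ _) (hrow _ _)) (hcol _ _)) (hrow _ _)
  have hdiag (D : (torusDet ι F).ker) : diagonalHom D ∈ K := by
    rw [← prod_coroot l D]
    change _ ∈ K.comap diagonalHom
    refine Subgroup.prod_mem _ fun i _ ↦ ?_
    rw [Subgroup.mem_comap]
    by_cases h : i = l
    · subst h
      have : coroot i i (D.1 i) = 1 := by ext1; simp [coroot, ← Pi.mulSingle_mul]
      simp [this, K.one_mem]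
    rw [diagonalHom_coroot h]
    exact K.mul_mem (K.mul_mem (K.mul_mem (K.mul_mem (hcol _ _) (hrow _ _)) (hcol _ _))
      (hrow _ _)) (hcol _ _)
  refine eq_top_iff.2 fun M _ ↦ ?_
  obtain ⟨L, L', D, hD, rfl⟩ := exists_list_transvec_mul_diagonal_mul_list_transvec M
  have hlist (L : List (TransvectionStruct ι F)) :
      (L.map TransvectionStruct.toSpecialLinearGroup).prod ∈ K := by
    refine K.list_prod_mem fun x hx ↦ ?_
    obtain ⟨t, _, rfl⟩ := List.mem_map.1 hx
    exact hall _ _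
  refine K.mul_mem (K.mul_mem (hlist L) ?_) (hlist L')
  have hprod : ∏ i, D i = 1 := by rwa [det_diagonal] at hD
  have hne (i : ι) : D i ≠ 0 := fun h ↦ by
    simp [Finset.prod_eq_zero (Finset.mem_univ i) h] at hprod
  exact hdiag ⟨fun i ↦ Units.mk0 (D i) (hne i), Units.ext (by simpa [torusDet] using hprod)⟩

section Real

open MeasureTheory Set Filter Topology

/-- A matrix with unit diagonal whose off-diagonal entries lie in the positions contracted by
the diagonal element `D` is contracted by `D`. -/
theorem mem_contractedSet_diagonalHom (D : (torusDet ι ℝ).ker) (x : SpecialLinearGroup ι ℝ)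
    (hx : ∀ i, x i i = 1)
    (hD : ∀ i j, i ≠ j → x i j ≠ 0 → |(D.1 i : ℝ) * (D.1 j : ℝ)⁻¹| < 1) :
    x ∈ contractedSet (diagonalHom D) := by
  refine (isClosedEmbedding_val (n := ι) (R := ℝ)).isInducing.tendsto_nhds_iff.2 ?_
  refine tendsto_pi_nhds.2 fun i ↦ tendsto_pi_nhds.2 fun j ↦ ?_
  have h (k : ℕ) : (diagonalHom D ^ k * x * (diagonalHom D ^ k)⁻¹) i j =
      ((D.1 i : ℝ) * (D.1 j : ℝ)⁻¹) ^ k * x i j := by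
    rw [← map_pow, diagonalHom_conj_apply]
    simp [mul_pow]
  refine Tendsto.congr (f₂ := fun k ↦ (diagonalHom D ^ k * x * (diagonalHom D ^ k)⁻¹) i j)
    (fun k ↦ (h k).symm) ?_
  rcases eq_or_ne i j with rfl | hij
  · simp [hx]
  rw [coe_one, one_apply_ne hij]
  by_cases h0 : x i j = 0
  · simp [h0]
  · simpa using (tendsto_pow_atTop_nhds_zero_of_abs_lt_one (hD i j hij h0)).mul_const (x i j)

/-- The matrix `1 + v eₗᵀ`, for a vector `v` with vanishing coordinate at `l`. -/
def columnUnipotent (l : ι) (v : ι → ℝ) (hv : v l = 0) : SpecialLinearGroup ι ℝ :=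
  ⟨1 + vecMulVec v (Pi.single l 1), by
    rw [vecMulVec_eq Unit, det_one_add_replicateCol_mul_replicateRow]
    simp [hv]⟩

theorem coe_columnUnipotent (l : ι) (v : ι → ℝ) (hv : v l = 0) :
    (columnUnipotent l v hv : Matrix ι ι ℝ) = 1 + vecMulVec v (Pi.single l 1) := rfl

theorem columnUnipotent_inv (l : ι) (v : ι → ℝ) (hv : v l = 0) :
    (columnUnipotent l v hv)⁻¹ = columnUnipotent l (-v) (by simp [hv]) := by
  refine inv_eq_of_mul_eq_one_left (Subtype.ext ?_)
  simp [coe_mul, coe_columnUnipotent, add_mul, mul_add, vecMulVec_mul_vecMulVec, hv]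

theorem columnUnipotent_smul (l : ι) (v : ι → ℝ) (hv : v l = 0) {w : ι → ℝ} (hw : w l = 0) :
    columnUnipotent l v hv • w = w := by
  simp [SpecialLinearGroup.smul_def, coe_columnUnipotent, add_mulVec, vecMulVec_mulVec, hw]

theorem columnUnipotent_mul_apply (l : ι) (v : ι → ℝ) (hv : v l = 0)
    (x : SpecialLinearGroup ι ℝ) (i j : ι) :
    (columnUnipotent l v hv * x) i j = x i j + v i * x l j := by
  simp [coe_mul, coe_columnUnipotent, add_mul, vecMulVec_mul, vecMulVec_apply]

/-- A neighbourhood of `1` is covered by cosets `u w` with `u` in the unipotent group of the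
column `l` and `w` in the opposite parabolic group, uniformly small under contraction. -/
theorem eventually_exists_columnUnipotent (l : ι) (D : (torusDet ι ℝ).ker)
    (h₁ : ∀ i j, i ≠ l → j ≠ l → D.1 i = D.1 j)
    (h₂ : ∀ j, j ≠ l → |(D.1 l : ℝ)⁻¹ * (D.1 j : ℝ)| < 1)
    {N : Set (SpecialLinearGroup ι ℝ)} (hN : N ∈ 𝓝 1) :
    ∀ᶠ x in 𝓝 (1 : SpecialLinearGroup ι ℝ), ∃ v, ∃ hv : v l = 0, ∀ k : ℕ,
      (diagonalHom D ^ k)⁻¹ * ((columnUnipotent l v hv)⁻¹ * x) * diagonalHom D ^ k ∈ N := by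
  obtain ⟨ε, hε, hbox⟩ : ∃ ε > 0, ∀ w : SpecialLinearGroup ι ℝ,
      (∀ i j, |w i j - (1 : Matrix ι ι ℝ) i j| < ε) → w ∈ N := by
    obtain ⟨t, ht, htN⟩ := mem_comap.1 <|
      ((isClosedEmbedding_val (n := ι) (R := ℝ)).isInducing.nhds_eq_comap
        (1 : SpecialLinearGroup ι ℝ)).ge hN
    obtain ⟨ε, hε, hball⟩ := (Metric.mem_nhds_iff (α := ι → ι → ℝ)).1 ht
    refine ⟨ε, hε, fun w hw ↦ htN (hball ?_)⟩
    exact (dist_pi_lt_iff hε).2 fun i ↦ (dist_pi_lt_iff hε).2 fun j ↦ hw i j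
  have hcont (i j : ι) : Continuous fun x : SpecialLinearGroup ι ℝ ↦ x i j := by fun_prop
  have hne : ∀ᶠ x in 𝓝 (1 : SpecialLinearGroup ι ℝ), x l l ≠ 0 :=
    (hcont l l).continuousAt.eventually_ne (by simp)
  have hsmall : ∀ᶠ x in 𝓝 (1 : SpecialLinearGroup ι ℝ), ∀ i j,
      |x i j + (if i = l then 0 else -(x i l / x l l)) * x l j - (1 : Matrix ι ι ℝ) i j| < ε := by
    refine eventually_all.2 fun i ↦ eventually_all.2 fun j ↦ ?_
    have hc : ContinuousAt (fun x : SpecialLinearGroup ι ℝ ↦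
        |x i j + (if i = l then 0 else -(x i l / x l l)) * x l j - (1 : Matrix ι ι ℝ) i j|) 1 := by
      have hdiv : ContinuousAt (fun x : SpecialLinearGroup ι ℝ ↦ x i l / x l l) 1 :=
        (hcont i l).continuousAt.div (hcont l l).continuousAt (by simp)
      split_ifs
      · exact (((hcont i j).continuousAt.add
          (continuousAt_const.mul (hcont l j).continuousAt)).sub continuousAt_const).abs
      · exact (((hcont i j).continuousAt.add
          (hdiv.neg.mul (hcont l j).continuousAt)).sub continuousAt_const).abs
    refine hc.eventually_lt continuousAt_const ?_
    rcases eq_or_ne i l with rfl | hi <;> simp [*]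
  filter_upwards [hne, hsmall] with x hxl hx
  refine ⟨fun i ↦ if i = l then 0 else x i l / x l l, by simp, fun k ↦ hbox _ fun i j ↦ ?_⟩
  rw [columnUnipotent_inv]
  set w := columnUnipotent l (-fun i ↦ if i = l then 0 else x i l / x l l) (by simp) * x with hw
  have hwij (i j : ι) : w i j = x i j + (if i = l then 0 else -(x i l / x l l)) * x l j := by
    rw [hw, columnUnipotent_mul_apply]
    by_cases hi : i = l <;> simp [hi]
  have hconj : ((diagonalHom D ^ k)⁻¹ * w * diagonalHom D ^ k) i j =
      ((D.1 i : ℝ)⁻¹ * (D.1 j : ℝ)) ^ k * w i j := by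
    have := diagonalHom_conj_apply ((D ^ k)⁻¹) w i j
    rw [map_inv, map_pow, inv_inv] at this
    rw [this]
    simp [mul_pow]
  have hwl : |w i j - (1 : Matrix ι ι ℝ) i j| < ε := by rw [hwij]; exact hx i j
  rw [hconj]
  rcases eq_or_ne i j with rfl | hij
  · simpa using hwl
  by_cases hj : j = l
  · have : w i j = 0 := by
      subst hj
      rw [hwij, if_neg hij]
      field_simp
      ring
    simpa [this, hij] using hε
  by_cases hi : i = l
  · subst hi
    rw [one_apply_ne hij, sub_zero] at hwl ⊢
    rw [abs_mul, abs_pow]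
    exact (mul_le_of_le_one_left (abs_nonneg _)
      (pow_le_one₀ (abs_nonneg _) (h₂ j hj).le)).trans_lt hwl
  · simpa [h₁ i j hi hj] using hwl

/-- The diagonal element with entry `2 ^ d` at `l` and `2⁻¹` elsewhere, in dimension `d + 1`. -/
noncomputable def columnTorus (l : ι) : (torusDet ι ℝ).ker :=
  ⟨fun i ↦ if i = l then Units.mk0 2 two_ne_zero ^ (Fintype.card ι - 1)
    else (Units.mk0 2 two_ne_zero)⁻¹, by
    rw [MonoidHom.mem_ker]
    change ∏ i, _ = _
    rw [Finset.prod_ite]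
    simp [Finset.filter_eq', Finset.filter_ne', Finset.card_erase_of_mem]⟩

theorem columnTorus_ratio (l : ι) {i : ι} (h : i ≠ l) :
    |((columnTorus l).1 i : ℝ) * ((columnTorus l).1 l : ℝ)⁻¹| < 1 := by
  simp only [columnTorus, if_neg h, if_true]
  push_cast
  rw [Units.val_mk0, ← mul_inv, abs_of_nonneg (by positivity)]
  refine inv_lt_one_of_one_lt₀ ?_
  nlinarith [one_le_pow₀ (n := Fintype.card ι - 1) (one_le_two : (1 : ℝ) ≤ 2)]

/-- `SL(ι, ℝ)` is generated by the elements contracted by `columnTorus l` or by its inverse. -/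
theorem closure_contractedSet_eq_top (l : ι) :
    Subgroup.closure (contractedSet (diagonalHom (columnTorus l)) ∪
      contractedSet (diagonalHom (columnTorus l))⁻¹) = ⊤ := by
  rw [eq_top_iff, ← closure_transvection_eq_top l]
  refine Subgroup.closure_mono ?_
  have hdiag {i j : ι} (h : i ≠ j) (b : ℝ) (p : ι) : transvection h b p p = 1 := by
    have : ¬(i = p ∧ j = p) := fun ⟨h₁, h₂⟩ ↦ h (h₁.trans h₂.symm)
    simp [transvection_coe, this]
  have hoff {i j : ι} (h : i ≠ j) (b : ℝ) {p q : ι} (hpq : p ≠ q)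
      (h0 : transvection h b p q ≠ 0) : i = p ∧ j = q := by
    by_contra hne
    simp [transvection_coe, hpq, hne] at h0
  rintro _ ⟨i, h, b, rfl | rfl⟩
  · refine .inl (mem_contractedSet_diagonalHom _ _ (hdiag h b) fun p q hpq h0 ↦ ?_)
    obtain ⟨rfl, rfl⟩ := hoff h b hpq h0
    exact columnTorus_ratio _ h
  · refine .inr ?_
    rw [← map_inv]
    refine mem_contractedSet_diagonalHom _ _ (hdiag h.symm b) fun p q hpq h0 ↦ ?_
    obtain ⟨rfl, rfl⟩ := hoff h.symm b hpq h0
    simpa [mul_comm] using columnTorus_ratio _ h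

/-- For a lattice `Γ` in `SL(ι, ℝ)` and the stabilizer `H` of the coordinate lines other than the
`l`-th one, all double cosets `Γ g H` are dense. -/
theorem dense_doubleCoset_stabilizer [MeasurableSpace (SpecialLinearGroup ι ℝ)]
    [BorelSpace (SpecialLinearGroup ι ℝ)] {Γ : Subgroup (SpecialLinearGroup ι ℝ)}
    [DiscreteTopology Γ] {μ : Measure (SpecialLinearGroup ι ℝ)} [μ.IsHaarMeasure]
    {D : Set (SpecialLinearGroup ι ℝ)} (hDm : MeasurableSet D)
    (hD : ∀ g : SpecialLinearGroup ι ℝ, ∃! γ : Γ, γ • g ∈ D) (hfin : μ D ≠ ⊤) (l : ι)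
    (g : SpecialLinearGroup ι ℝ) :
    Dense {x | ∃ γ : Γ, ∃ h : SpecialLinearGroup ι ℝ,
      (∀ j, j ≠ l → ∃ c : ℝ, h • (Pi.single j 1 : ι → ℝ) = c • Pi.single j 1) ∧
        x = γ * g * h} := by
  have hemb := isClosedEmbedding_val (n := ι) (R := ℝ)
  have : SecondCountableTopology (Matrix ι ι ℝ) :=
    inferInstanceAs (SecondCountableTopology (ι → ι → ℝ))
  have : LocallyCompactSpace (Matrix ι ι ℝ) := inferInstanceAs (LocallyCompactSpace (ι → ι → ℝ))
  have : SecondCountableTopology (SpecialLinearGroup ι ℝ) :=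
    hemb.isEmbedding.secondCountableTopology
  have : LocallyCompactSpace (SpecialLinearGroup ι ℝ) := hemb.locallyCompactSpace
  have : Countable Γ := TopologicalSpace.separableSpace_iff_countable.1 inferInstance
  have := isMulRightInvariant_of_fundamentalDomain hDm hD hfin
  let H : Subgroup (SpecialLinearGroup ι ℝ) :=
    ⨅ (j : ι) (_ : j ≠ l), MulAction.stabilizer _
      (Projectivization.mk ℝ (Pi.single j 1 : ι → ℝ) (by simp))
  have hH {h : SpecialLinearGroup ι ℝ} : h ∈ H ↔
      ∀ j, j ≠ l → ∃ c : ℝ, h • (Pi.single j 1 : ι → ℝ) = c • Pi.single j 1 := by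
    simp only [H, Subgroup.mem_iInf, MulAction.mem_stabilizer_iff, Projectivization.smul_mk,
      Projectivization.mk_eq_mk_iff']
    exact forall₂_congr fun j _ ↦ exists_congr fun c ↦ eq_comm
  have hT : diagonalHom (columnTorus l) ∈ H := hH.2 fun j _ ↦ ⟨((columnTorus l).1 j : ℝ), by
    simp [SpecialLinearGroup.smul_def, coe_diagonalHom, ← Pi.single_smul]⟩
  refine (dense_doubleCoset hDm hD hfin hT (closure_contractedSet_eq_top l)
    (fun N hN ↦ ?_) g).mono ?_
  · filter_upwards [eventually_exists_columnUnipotent l (columnTorus l)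
      (fun i j hi hj ↦ by simp [columnTorus, hi, hj])
      (fun j hj ↦ by simpa [mul_comm] using columnTorus_ratio l hj) hN] with x ⟨v, hv, hx⟩
    exact ⟨_, hH.2 fun j hj ↦ ⟨1, by rw [columnUnipotent_smul _ _ _ (by simp [hj]), one_smul]⟩, hx⟩
  · rintro x ⟨γ, h, hh, rfl⟩
    exact ⟨γ, h, hH.1 hh, rfl⟩

end Real

end Matrix.SpecialLinearGroup

/-- The `i`-th coordinate line. -/
noncomputable def coordLine {n : ℕ} (i : Fin n) : Proj n :=
  Projectivization.mk ℝ (Pi.single i 1) (by simp)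

theorem actR_mk {n : ℕ} (g : SLR n) (v : Fin n → ℝ) (hv : v ≠ 0) :
    actR g (Projectivization.mk ℝ v hv) =
      Projectivization.mk ℝ (Matrix.SpecialLinearGroup.toLin' g v)
        ((map_ne_zero_iff _ (Matrix.SpecialLinearGroup.toLin' g).injective).2 hv) := rfl

theorem actR_mul {n : ℕ} (g h : SLR n) (x : Proj n) : actR (g * h) x = actR g (actR h x) := by
  induction x using Projectivization.ind with | _ v hv
  simp [actR_mk]

theorem continuous_actR {n : ℕ} (x : Proj n) : Continuous fun g : SLR n ↦ actR g x := by
  induction x using Projectivization.ind with | _ v hv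
  have h : Continuous fun g : SLR n ↦ (g : Matrix (Fin n) (Fin n) ℝ) *ᵥ v :=
    Continuous.matrix_mulVec continuous_subtype_val continuous_const
  exact continuous_quotient_mk'.comp (h.subtype_mk fun g ↦
    (map_ne_zero_iff _ (Matrix.SpecialLinearGroup.toLin' g).injective).2 hv)

/-- `SL(m + 1, ℝ)` is transitive on independent `m`-tuples of points of projective space. -/
theorem exists_actR_coordLine_eq {m : ℕ} {f : Fin m → Proj (m + 1)}
    (hf : Projectivization.Independent f) :
    ∃ g : SLR (m + 1), ∀ i : Fin m, actR g (coordLine i.castSucc) = f i := by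
  rw [Projectivization.independent_iff] at hf
  set v : Fin m → Fin (m + 1) → ℝ := Projectivization.rep ∘ f
  obtain ⟨x, hx⟩ : ∃ x, x ∉ Submodule.span ℝ (Set.range v) := by
    by_contra! h
    have := finrank_range_le_card (R := ℝ) v
    rw [Set.finrank, Submodule.eq_top_iff'.2 h, finrank_top] at this
    simp at this
  set A : Matrix (Fin (m + 1)) (Fin (m + 1)) ℝ := Matrix.of (Fin.snoc v x)
  have hdet : A.det ≠ 0 := by
    rw [← isUnit_iff_ne_zero, ← Matrix.isUnit_iff_isUnit_det]
    exact Matrix.linearIndependent_rows_iff_isUnit.1 (linearIndependent_finSnoc.2 ⟨hf, hx⟩)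
  have hdet' : (A.updateRow (Fin.last m) (A.det⁻¹ • x))ᵀ.det = 1 := by
    have hx : A (Fin.last m) = x := Fin.snoc_last (α := fun _ ↦ Fin (m + 1) → ℝ) x v
    rw [det_transpose, det_updateRow_smul, ← hx, updateRow_eq_self, inv_mul_cancel₀ hdet]
  let g : SLR (m + 1) := ⟨_, hdet'⟩
  refine ⟨g, fun i ↦ ?_⟩
  rw [coordLine, actR_mk, ← Projectivization.mk_rep (f i), Projectivization.mk_eq_mk_iff']
  refine ⟨1, ?_⟩
  change _ = (A.updateRow (Fin.last m) (A.det⁻¹ • x))ᵀ *ᵥ Pi.single i.castSucc 1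
  rw [one_smul, mulVec_single_one]
  change _ = A.updateRow (Fin.last m) (A.det⁻¹ • x) i.castSucc
  rw [updateRow_ne (Fin.castSucc_ne_last i)]
  exact (Fin.snoc_castSucc (α := fun _ ↦ Fin (m + 1) → ℝ) x v i).symm

/-- Theorem 2.9 (Conze–Guivarc'h): a lattice `Γ ≤ SL(n,ℝ)`, `n ≥ 3`, acts minimally
on the set of generic `(n-1)`-tuples of `ℙ^{n-1}(ℝ)`: every orbit is dense. -/
theorem conze_guivarch_minimal (n : ℕ) (hn : 3 ≤ n) (Γ : Subgroup (SLR n))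
    (hΓ : IsLatticeIn Γ) (f : Fin (n - 1) → Proj n)
    (hf : Projectivization.Independent f) :
    ∀ f' : Fin (n - 1) → Proj n, Projectivization.Independent f' →
      f' ∈ closure {h : Fin (n - 1) → Proj n | ∃ γ ∈ Γ, h = fun i => actR γ (f i)} := by
  obtain ⟨m, rfl⟩ : ∃ m, n = m + 1 := ⟨n - 1, by omega⟩
  intro f' hf'
  obtain ⟨g, hg⟩ := exists_actR_coordLine_eq (m := m) hf
  obtain ⟨g', hg'⟩ := exists_actR_coordLine_eq (m := m) hf'
  obtain ⟨hdisc, μ, hμ, D, hDm, hfin, hD⟩ := hΓ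
  have hD' (g : SLR (m + 1)) : ∃! γ : Γ, γ • g ∈ D := by
    obtain ⟨γ, hγ, huniq⟩ := hD g
    refine ⟨γ⁻¹, by simpa [Subgroup.smul_def] using hγ, fun δ hδ ↦ ?_⟩
    exact inv_eq_iff_eq_inv.1 (huniq δ⁻¹ (by simpa [Subgroup.smul_def] using hδ))
  have hdense := @Matrix.SpecialLinearGroup.dense_doubleCoset_stabilizer (Fin (m + 1)) _ _ _ ⟨rfl⟩
    Γ hdisc μ hμ D hDm hD' hfin.ne (Fin.last m) g
  have hcont : Continuous fun (x : SLR (m + 1)) (i : Fin m) ↦ actR x (coordLine i.castSucc) :=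
    continuous_pi fun i ↦ continuous_actR _
  rw [← funext hg']
  refine closure_mono ?_ (mem_closure_image hcont.continuousAt (hdense g'))
  rintro _ ⟨_, ⟨γ, h, hh, rfl⟩, rfl⟩
  refine ⟨γ, γ.2, funext fun i ↦ ?_⟩
  obtain ⟨c, hc⟩ := hh i.castSucc (Fin.castSucc_ne_last i)
  have hfix : actR h (coordLine i.castSucc) = coordLine i.castSucc := by
    rw [coordLine, actR_mk, Projectivization.mk_eq_mk_iff']
    exact ⟨c, hc.symm⟩
  change actR ((γ : SLR (m + 1)) * g * h) (coordLine i.castSucc) = _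
  rw [actR_mul, actR_mul, hfix, hg]
end
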